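/- Let Y be a Banach space and let T : ℓ² → Y be an injective bounded linear operator. Define A : ℓ¹ → Y by A x = T x, using that every x ∈ ℓ¹ also lies in ℓ². Then the range A(ℓ¹) contains no infinite dimensional closed subspace of Y (and, combined with the fact that A(ℓ¹) is not closed, the equation A x = y is always ill-posed of type II). -/

import Mathlib

open scoped ENNReal

noncomputable section

/-- The space `ℓ¹` of absolutely summable real sequences. -/
abbrev ell1 : Type := lp (fun _ : ℕ => ℝ) 1

/-- The space `ℓ²` of square-summable real sequences. -/
abbrev ell2 : Type := lp (fun _ : ℕ => ℝ) 2

/-- The natural embedding `ℓ¹ → ℓ²`. -/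
def incl12 (x : ell1) : ell2 :=
  ⟨(x : ℕ → ℝ), (lp.memℓp x).of_exponent_ge (by norm_num)⟩

theorem ell1_hasSum_abs (x : ell1) : HasSum (fun i => |x i|) ‖x‖ := by
  simpa using lp.hasSum_norm (p := 1) (by norm_num) x

theorem ell2_hasSum_sq (x : ell2) : HasSum (fun i => x i ^ 2) (‖x‖ ^ 2) := by
  simpa using lp.hasSum_norm (p := 2) (by norm_num) x

theorem ell1_abs_apply_le_norm (x : ell1) (i : ℕ) : |x i| ≤ ‖x‖ := by
  simpa using lp.norm_apply_le_norm one_ne_zero x i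

/-- The embedding `ℓ¹ → ℓ²` does not increase norms. -/
theorem norm_incl12_le (x : ell1) : ‖incl12 x‖ ≤ ‖x‖ := by
  refine le_of_sq_le_sq ?_ (norm_nonneg x)
  rw [sq ‖x‖]
  refine hasSum_le (fun i => ?_) (ell2_hasSum_sq (incl12 x)) ((ell1_hasSum_abs x).mul_left ‖x‖)
  change x i ^ 2 ≤ _
  rw [← sq_abs, sq]
  exact mul_le_mul_of_nonneg_right (ell1_abs_apply_le_norm x i) (abs_nonneg _)

theorem coe_incl12 (x : ell1) (i : ℕ) : incl12 x i = x i := rfl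

theorem incl12_add (x y : ell1) : incl12 (x + y) = incl12 x + incl12 y := by
  ext i
  simp only [coe_incl12, lp.coeFn_add, Pi.add_apply]

theorem incl12_smul (c : ℝ) (x : ell1) : incl12 (c • x) = c • incl12 x := by
  ext i
  simp only [coe_incl12, lp.coeFn_smul, Pi.smul_apply]

theorem incl12_injective : Function.Injective incl12 := fun x y h => by
  ext i
  rw [← coe_incl12 x, h, coe_incl12]

/-- The embedding `ℓ¹ → ℓ²` as a bounded linear operator. -/
def incl12CLM : ell1 →L[ℝ] ell2 :=
  LinearMap.mkContinuous
    { toFun := incl12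
      map_add' := incl12_add
      map_smul' := incl12_smul } 1 (fun x => (norm_incl12_le x).trans_eq (one_mul _).symm)

/-- An infinite dimensional subspace of `ℓ¹` contains unit vectors vanishing on any prescribed
finite set of coordinates. -/
theorem exists_norm_eq_one_of_not_finiteDimensional {N : Submodule ℝ ell1}
    (hN : ¬ FiniteDimensional ℝ N) (s : Finset ℕ) :
    ∃ y ∈ N, ‖y‖ = 1 ∧ ∀ i ∈ s, y i = 0 := by
  let f : N →ₗ[ℝ] (s → ℝ) :=
    { toFun := fun x i => (x : ell1) i
      map_add' := fun _ _ => rfl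
      map_smul' := fun _ _ => rfl }
  have hf : ¬ Function.Injective f := fun h => hN (FiniteDimensional.of_injective f h)
  rw [injective_iff_map_eq_zero] at hf
  push Not at hf
  obtain ⟨z, hz, hz0⟩ := hf
  have hz0' : (z : ell1) ≠ 0 := by simpa using hz0
  refine ⟨‖(z : ell1)‖⁻¹ • (z : ell1), N.smul_mem _ z.2, norm_smul_inv_norm hz0', fun i hi => ?_⟩
  have : (z : ell1) i = 0 := congrFun hz ⟨i, hi⟩
  simp [this]

/-- A unit vector of an infinite dimensional subspace can be chosen almost disjoint from a given
vector, so that adding it nearly adds the `ℓ¹` norms and the squares of the `ℓ²` norms. -/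
theorem exists_almost_disjoint {N : Submodule ℝ ell1}
    (hN : ¬ FiniteDimensional ℝ N) (x : ell1) :
    ∃ y ∈ N, ‖x‖ + 1 / 2 ≤ ‖x + y‖ ∧
      ‖incl12 (x + y)‖ ^ 2 ≤ ‖incl12 x‖ ^ 2 + 3 / 2 := by
  obtain ⟨s, hs⟩ := ((tendsto_order.1 (tendsto_tsum_compl_atTop_zero
    (fun i => |x i|))).2 (1 / 4) (by norm_num)).exists
  obtain ⟨y, hyN, hy1, hys⟩ := exists_norm_eq_one_of_not_finiteDimensional hN s
  set t : ℕ → ℝ := ({i | i ∉ s} : Set ℕ).indicator (fun i => |x i|) with ht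
  have hts : HasSum t (∑' i, t i) := ((ell1_hasSum_abs x).summable.indicator _).hasSum
  have ht4 : ∑' i, t i < 1 / 4 := by
    rw [ht, ← tsum_subtype]
    exact hs
  have hyle (i : ℕ) : |y i| ≤ 1 := hy1 ▸ ell1_abs_apply_le_norm y i
  refine ⟨y, hyN, ?_, ?_⟩
  · have key := hasSum_le (fun i => ?_)
      (((ell1_hasSum_abs x).add (ell1_hasSum_abs y)).sub (hts.mul_left 2))
      (ell1_hasSum_abs (x + y))
    · linarith
    · change |x i| + |y i| - 2 * t i ≤ |x i + y i|
      by_cases hi : i ∈ s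
      · simp [ht, hi, hys i hi]
      · have h := abs_sub_abs_le_abs_sub (y i) (-x i)
        rw [abs_neg, sub_neg_eq_add, add_comm (y i)] at h
        simp only [ht, Set.indicator, Set.mem_ofPred_eq, hi, not_false_eq_true, if_true]
        linarith
  · have hxy : inner ℝ (incl12 x) (incl12 y) ≤ ∑' i, t i := by
      refine hasSum_le (fun i => ?_) (lp.hasSum_inner (𝕜 := ℝ) (incl12 x) (incl12 y)) hts
      change y i * x i ≤ t i
      by_cases hi : i ∈ s
      · simp [ht, hi, hys i hi]
      · simp only [ht, Set.indicator, Set.mem_ofPred_eq, hi, not_false_eq_true, if_true]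
        calc y i * x i ≤ |y i| * |x i| := by rw [← abs_mul]; exact le_abs_self _
          _ ≤ |x i| := mul_le_of_le_one_left (abs_nonneg _) (hyle i)
    have hy2 : ‖incl12 y‖ ^ 2 ≤ 1 :=
      pow_le_one₀ (norm_nonneg _) (hy1 ▸ norm_incl12_le y)
    rw [incl12_add, norm_add_sq_real]
    linarith

/-- The `ℓ¹` and `ℓ²` norms are not equivalent on an infinite dimensional subspace of `ℓ¹`, i.e.
the embedding `ℓ¹ → ℓ²` is strictly singular. -/
theorem finiteDimensional_of_norm_le_mul_norm_incl12 {N : Submodule ℝ ell1} {C : ℝ}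
    (hC : ∀ x ∈ N, ‖x‖ ≤ C * ‖incl12 x‖) : FiniteDimensional ℝ N := by
  by_contra hN
  have hgrow (n : ℕ) : ∃ x ∈ N, (n : ℝ) / 2 ≤ ‖x‖ ∧ ‖incl12 x‖ ^ 2 ≤ 3 * n / 2 := by
    induction n with
    | zero =>
      have h0 : incl12 0 = 0 := map_zero incl12CLM
      exact ⟨0, N.zero_mem, by simp, by simp [h0]⟩
    | succ n ih =>
      obtain ⟨x, hx, h1, h2⟩ := ih
      obtain ⟨y, hy, h3, h4⟩ := exists_almost_disjoint hN x
      refine ⟨x + y, N.add_mem hx hy, ?_, ?_⟩ <;> push_cast <;> linarith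
  obtain ⟨n, hn⟩ := exists_nat_gt (6 * C ^ 2)
  obtain ⟨x, hx, h1, h2⟩ := hgrow n
  have hn0 : (0 : ℝ) < n := lt_of_le_of_lt (by positivity) hn
  have h3 : ((n : ℝ) / 2) ^ 2 ≤ C ^ 2 * (3 * n / 2) :=
    calc ((n : ℝ) / 2) ^ 2 ≤ (C * ‖incl12 x‖) ^ 2 :=
          pow_le_pow_left₀ (by positivity) (h1.trans (hC x hx)) 2
      _ = C ^ 2 * ‖incl12 x‖ ^ 2 := mul_pow _ _ _
      _ ≤ C ^ 2 * (3 * n / 2) := by gcongr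
  nlinarith [mul_lt_mul_of_pos_right hn hn0]

/-- If `T : ℓ² → Y` is an injective bounded linear operator into a Banach space and
`A : ℓ¹ → Y` is defined by `A x = T x` (via the embedding `ℓ¹ ⊆ ℓ²`), then the range of `A`
contains no infinite dimensional closed subspace of `Y` (so, since the range is also not
closed, the equation `A x = y` is always ill-posed of type II). -/
theorem range_of_ell1_restriction_no_infinite_dim_closed_subspace
    {Y : Type*} [NormedAddCommGroup Y] [NormedSpace ℝ Y] [CompleteSpace Y]
    (T : ell2 →L[ℝ] Y) (hT : Function.Injective T) :
    ∀ M : Submodule ℝ Y, IsClosed (M : Set Y) →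
      (M : Set Y) ⊆ Set.range (fun x : ell1 => T (incl12 x)) →
      FiniteDimensional ℝ M := by
  intro M hM hMA
  let A : ell1 →L[ℝ] Y := T.comp incl12CLM
  have hA : Function.Injective A := hT.comp incl12_injective
  let N : Submodule ℝ ell1 := M.comap A.toLinearMap
  have hN : IsClosed (N : Set ell1) := hM.preimage A.continuous
  have : CompleteSpace N := hN.completeSpace_coe
  let B : N →L[ℝ] Y := A.comp N.subtypeL
  have hB : Set.range B = M := by
    ext y
    constructor
    · rintro ⟨x, rfl⟩
      exact x.2
    · intro hy
      obtain ⟨x, rfl⟩ := hMA hy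
      exact ⟨⟨x, hy⟩, rfl⟩
  obtain ⟨K, hK⟩ := B.antilipschitz_of_injective_of_isClosed_range
    (hA.comp Subtype.val_injective) (hB ▸ hM)
  have : FiniteDimensional ℝ N := by
    refine finiteDimensional_of_norm_le_mul_norm_incl12 (C := K * ‖T‖) fun x hx => ?_
    calc ‖x‖ ≤ K * ‖T (incl12 x)‖ := ZeroHomClass.bound_of_antilipschitz B hK ⟨x, hx⟩
      _ ≤ K * (‖T‖ * ‖incl12 x‖) := by gcongr; exact T.le_opNorm _
      _ = K * ‖T‖ * ‖incl12 x‖ := (mul_assoc _ _ _).symm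
  have hBM : B.toLinearMap.range = M := SetLike.coe_injective hB
  rw [← hBM]
  infer_instance
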